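/- Let n ≥ 5. Then f^{n−3}(n) + f^{n−2}(n) = n − 4. -/

import Mathlib

namespace ConvexBlockers

/-- Cyclic distance between two vertices of the convex `n`-gon (vertices = `ZMod n`). -/
def cyclicDist {n : ℕ} (i j : ZMod n) : ℕ := min (i - j).val (j - i).val

/-- A diagonal: an unordered pair of vertices at cyclic distance at least 2. -/
def IsDiagonal {n : ℕ} (e : Sym2 (ZMod n)) : Prop :=
  ∃ i j : ZMod n, e = s(i, j) ∧ 2 ≤ cyclicDist i j

/-- An ear-cover: a diagonal of cyclic distance exactly 2. -/
def IsEarCover {n : ℕ} (e : Sym2 (ZMod n)) : Prop :=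
  ∃ i j : ZMod n, e = s(i, j) ∧ cyclicDist i j = 2

/-- `Btw a x b` : `x` lies strictly inside the clockwise arc from `a` to `b`. -/
def Btw {n : ℕ} (a x b : ZMod n) : Prop :=
  0 < (x - a).val ∧ (x - a).val < (b - a).val

/-- Two diagonals cross iff their endpoint pairs strictly interleave in the cyclic order. -/
def Crosses {n : ℕ} (e f : Sym2 (ZMod n)) : Prop :=
  ∃ a b c d : ZMod n, e = s(a, b) ∧ f = s(c, d) ∧ Btw a c b ∧ Btw b d a

/-- A triangulation: a maximal (w.r.t. inclusion) set of pairwise non-crossing diagonals. -/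
def IsTriangulation {n : ℕ} (T : Set (Sym2 (ZMod n))) : Prop :=
  (∀ e ∈ T, IsDiagonal e) ∧
  (∀ e ∈ T, ∀ f ∈ T, ¬ Crosses e f) ∧
  (∀ T' : Set (Sym2 (ZMod n)), (∀ e ∈ T', IsDiagonal e) →
    (∀ e ∈ T', ∀ f ∈ T', ¬ Crosses e f) → T ⊆ T' → T' = T)

/-- A blocking set: a set of diagonals meeting every triangulation. -/
def IsBlockingSet {n : ℕ} (B : Set (Sym2 (ZMod n))) : Prop :=
  (∀ e ∈ B, IsDiagonal e) ∧
  ∀ T : Set (Sym2 (ZMod n)), IsTriangulation T → (B ∩ T).Nonempty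

/-- A blocker: a blocking set of minimum possible cardinality. -/
def IsBlocker {n : ℕ} (B : Set (Sym2 (ZMod n))) : Prop :=
  IsBlockingSet B ∧
  ∀ B' : Set (Sym2 (ZMod n)), IsBlockingSet B' → B.ncard ≤ B'.ncard

/-- f^j(i): the number of blockers of the convex i-gon whose set of ear-covers is exactly
the run {{t, t+2} : 0 ≤ t ≤ j-1} of j consecutive ear-covers starting at vertex 0. -/
noncomputable def blockerCountRun (i j : ℕ) : ℕ :=
  Set.ncard {B : Set (Sym2 (ZMod i)) | IsBlocker B ∧
    {e ∈ B | IsEarCover e} =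
      {e : Sym2 (ZMod i) | ∃ t : ℕ, t < j ∧ e = s((t : ZMod i), (t : ZMod i) + 2)}}

/-- Interleaving of two pairs of numbers, each written in increasing order. -/
def Interleave (e f : ℕ × ℕ) : Prop :=
  (e.1 < f.1 ∧ f.1 < e.2 ∧ e.2 < f.2) ∨ (f.1 < e.1 ∧ e.1 < f.2 ∧ f.2 < e.2)

/-- `IsChord S e`: the increasing pair `e` is a diagonal of the convex polygon with vertex set `S`. -/
def IsChord (S : Finset ℕ) (e : ℕ × ℕ) : Prop :=
  e.1 ∈ S ∧ e.2 ∈ S ∧ (∃ x ∈ S, e.1 < x ∧ x < e.2) ∧ ∃ y ∈ S, y < e.1 ∨ e.2 < y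

/-- Three elements `p < v < q` of `S` that are consecutive in `S`. -/
def Consecutive (S : Finset ℕ) (p v q : ℕ) : Prop :=
  p ∈ S ∧ v ∈ S ∧ q ∈ S ∧ p < v ∧ v < q ∧ (∀ x ∈ S, x < v → x ≤ p) ∧ ∀ x ∈ S, v < x → q ≤ x

theorem exists_consecutive_notMem (S : Finset ℕ) (B : Finset (ℕ × ℕ)) (h : B.card + 3 ≤ S.card) :
    ∃ p v q, Consecutive S p v q ∧ (p, q) ∉ B := by
  have hne : S.Nonempty := Finset.card_pos.mp (by omega)
  by_contra! hB
  let I := (S.erase (S.min' hne)).erase (S.max' hne)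
  have hI : ∀ v ∈ I, ∃ p q, Consecutive S p v q := by
    intro v hv
    simp only [I, Finset.mem_erase] at hv
    obtain ⟨hmax, hmin, hvS⟩ := hv
    have hlt : S.min' hne < v := lt_of_le_of_ne (S.min'_le v hvS) (Ne.symm hmin)
    have hgt : v < S.max' hne := lt_of_le_of_ne (S.le_max' v hvS) hmax
    have hl : (S.filter (· < v)).Nonempty :=
      ⟨_, Finset.mem_filter.mpr ⟨S.min'_mem hne, hlt⟩⟩
    have hr : (S.filter (v < ·)).Nonempty :=
      ⟨_, Finset.mem_filter.mpr ⟨S.max'_mem hne, hgt⟩⟩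
    have hp := Finset.mem_filter.mp (Finset.max'_mem _ hl)
    have hq := Finset.mem_filter.mp (Finset.min'_mem _ hr)
    exact ⟨_, _, hp.1, hvS, hq.1, hp.2, hq.2,
      fun x hx hxv => Finset.le_max' _ _ (Finset.mem_filter.mpr ⟨hx, hxv⟩),
      fun x hx hxv => Finset.min'_le _ _ (Finset.mem_filter.mpr ⟨hx, hxv⟩)⟩
  choose! p q hpq using hI
  have hcard : I.card ≤ B.card := by
    refine Finset.card_le_card_of_injOn (fun v => (p v, q v)) (fun v hv => hB _ _ _ (hpq v hv)) ?_
    intro v hv w hw hvw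
    obtain ⟨-, hvS, -, h1, -, h2, -⟩ := hpq v hv
    obtain ⟨-, hwS, -, h3, -, h4, -⟩ := hpq w hw
    have := (Prod.ext_iff.mp hvw).1
    have a := h2 w hwS
    have b := h4 v hvS
    simp only at this
    omega
  have h1 := Finset.pred_card_le_card_erase (s := S) (a := S.min' hne)
  have h2 := Finset.pred_card_le_card_erase (s := S.erase (S.min' hne)) (a := S.max' hne)
  simp only [I] at hcard
  omega

/-- Fewer than `|S| - 2` chords can be crossed simultaneously by a non-crossing set of chords. -/
theorem exists_noncrossing_of_card (m : ℕ) (S : Finset ℕ) (hS : S.card = m + 3)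
    (B : Finset (ℕ × ℕ)) (hB : B.card ≤ m) (hBS : ∀ e ∈ B, IsChord S e) :
    ∃ T : Set (ℕ × ℕ), (∀ e ∈ T, IsChord S e) ∧ (∀ e ∈ T, ∀ f ∈ T, ¬ Interleave e f) ∧
      ∀ e ∈ B, ∃ f ∈ T, Interleave e f := by
  induction m generalizing S B with
  | zero =>
    have : B = ∅ := Finset.card_eq_zero.mp (by omega)
    subst this
    exact ⟨∅, by simp, by simp, by simp⟩
  | succ m ih =>
    obtain ⟨p, v, q, ⟨hp, hv, hq, hpv, hvq, hl, hr⟩, hpqB⟩ :=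
      exists_consecutive_notMem S B (by omega)
    by_cases hdeg : ∃ e ∈ B, e.1 = v ∨ e.2 = v
    · obtain ⟨e, heB, hev⟩ := hdeg
      have hcard : (B.filter (fun e => ¬ (e.1 = v ∨ e.2 = v))).card < B.card :=
        Finset.card_lt_card (Finset.filter_ssubset.mpr ⟨e, heB, not_not.mpr hev⟩)
      obtain ⟨T, hT, hTT, hTB⟩ := ih (S.erase v) (by rw [Finset.card_erase_of_mem hv]; omega)
        (B.filter (fun e => ¬ (e.1 = v ∨ e.2 = v))) (by omega) (by
          rintro ⟨a, b⟩ hab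
          simp only [Finset.mem_filter, not_or] at hab
          obtain ⟨habB, hav, hbv⟩ := hab
          obtain ⟨ha, hb, ⟨x, hx, hx1, hx2⟩, y, hy, hy'⟩ := hBS _ habB
          simp only at ha hb hx1 hx2 hy'
          have hne : a ≠ p ∨ b ≠ q := by
            by_contra! h
            exact hpqB (h.1 ▸ h.2 ▸ habB)
          have h1 := hl a ha
          have h2 := hr a ha
          have h3 := hl b hb
          have h4 := hr b hb
          refine ⟨Finset.mem_erase.mpr ⟨hav, ha⟩, Finset.mem_erase.mpr ⟨hbv, hb⟩, ?_, ?_⟩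
          · by_cases hxv : x = v
            · by_cases hap : a = p
              · exact ⟨q, Finset.mem_erase.mpr ⟨by omega, hq⟩, by dsimp only; omega,
                  by dsimp only; omega⟩
              · exact ⟨p, Finset.mem_erase.mpr ⟨by omega, hp⟩, by dsimp only; omega,
                  by dsimp only; omega⟩
            · exact ⟨x, Finset.mem_erase.mpr ⟨hxv, hx⟩, hx1, hx2⟩
          · by_cases hyv : y = v
            · rcases hy' with hy' | hy'
              · exact ⟨p, Finset.mem_erase.mpr ⟨by omega, hp⟩, Or.inl (by dsimp only; omega)⟩
              · exact ⟨q, Finset.mem_erase.mpr ⟨by omega, hq⟩, Or.inr (by dsimp only; omega)⟩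
            · exact ⟨y, Finset.mem_erase.mpr ⟨hyv, hy⟩, hy'⟩)
      have hcut : ∀ e ∈ B, e.1 = v ∨ e.2 = v → Interleave e (p, q) := by
        rintro ⟨a, b⟩ hab hv'
        obtain ⟨ha, hb, ⟨x, hx, hx1, hx2⟩, -⟩ := hBS _ hab
        have h1 := hl a ha
        have h4 := hr b hb
        have h5 := hl x hx
        have h6 := hr x hx
        simp only [Interleave] at *
        omega
      have hsides : ∀ e ∈ T, ¬ Interleave e (p, q) ∧ ¬ Interleave (p, q) e := by
        rintro ⟨a, b⟩ hab
        obtain ⟨ha, hb, -⟩ := hT _ hab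
        simp only [Finset.mem_erase] at ha hb
        have h1 := hl a ha.2
        have h2 := hr a ha.2
        have h3 := hl b hb.2
        have h4 := hr b hb.2
        simp only [Interleave]
        omega
      refine ⟨insert (p, q) T, ?_, ?_, ?_⟩
      · rintro f (rfl | hf)
        · refine ⟨hp, hq, ⟨v, hv, hpv, hvq⟩, ?_⟩
          obtain ⟨h1, h2, -⟩ := hBS _ heB
          have := hcut e heB hev
          simp only [Interleave] at this
          rcases this with h | h
          · exact ⟨e.1, h1, Or.inl h.1⟩
          · exact ⟨e.2, h2, Or.inr h.2.2⟩
        · obtain ⟨ha, hb, ⟨x, hx, hx'⟩, y, hy, hy'⟩ := hT f hf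
          exact ⟨Finset.mem_of_mem_erase ha, Finset.mem_of_mem_erase hb,
            ⟨x, Finset.mem_of_mem_erase hx, hx'⟩, y, Finset.mem_of_mem_erase hy, hy'⟩
      · rintro f (rfl | hf) g (rfl | hg)
        · simp [Interleave]
        · exact (hsides g hg).2
        · exact (hsides f hf).1
        · exact hTT f hf g hg
      · intro f hf
        by_cases hfv : f.1 = v ∨ f.2 = v
        · exact ⟨(p, q), Set.mem_insert _ _, hcut f hf hfv⟩
        · obtain ⟨g, hg, hfg⟩ := hTB f (Finset.mem_filter.mpr ⟨hf, hfv⟩)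
          exact ⟨g, Set.mem_insert_of_mem _ hg, hfg⟩
    · push Not at hdeg
      refine ⟨{e | IsChord S e ∧ (e.1 = v ∨ e.2 = v)}, fun e he => he.1, ?_, ?_⟩
      · rintro ⟨a, b⟩ ⟨-, h1⟩ ⟨c, d⟩ ⟨-, h2⟩
        simp only [Interleave] at *
        omega
      · rintro ⟨a, b⟩ hab
        obtain ⟨hav, hbv⟩ := hdeg _ hab
        obtain ⟨ha, hb, ⟨x, hx, hx1, hx2⟩, y, hy, hy'⟩ := hBS _ hab
        simp only at ha hb hx1 hx2 hy' hav hbv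
        rcases lt_or_gt_of_ne hav with h1 | h1
        · rcases lt_or_gt_of_ne hbv with h2 | h2
          · exact ⟨(x, v), ⟨⟨hx, hv, ⟨b, hb, hx2, h2⟩, a, ha, Or.inl hx1⟩, Or.inr rfl⟩,
              Or.inl ⟨hx1, hx2, h2⟩⟩
          · rcases hy' with hy' | hy'
            · exact ⟨(y, v), ⟨⟨hy, hv, ⟨a, ha, hy', h1⟩, b, hb, Or.inr h2⟩, Or.inr rfl⟩,
                Or.inr ⟨hy', h1, h2⟩⟩
            · exact ⟨(v, y), ⟨⟨hv, hy, ⟨b, hb, h2, hy'⟩, a, ha, Or.inl h1⟩, Or.inl rfl⟩,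
                Or.inl ⟨h1, h2, hy'⟩⟩
        · exact ⟨(v, x), ⟨⟨hv, hx, ⟨a, ha, h1, hx1⟩, b, hb, Or.inr hx2⟩, Or.inl rfl⟩,
            Or.inr ⟨h1, hx1, hx2⟩⟩

/-- The unordered pair of vertices of the `n`-gon with the given indices. -/
def toSym2 (n : ℕ) (e : ℕ × ℕ) : Sym2 (ZMod n) := s((e.1 : ZMod n), (e.2 : ZMod n))

theorem val_sub_eq {n : ℕ} [NeZero n] (a b : ZMod n) :
    (a - b).val = if b.val ≤ a.val then a.val - b.val else n + a.val - b.val := by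
  have ha := a.val_lt
  have hb := b.val_lt
  split_ifs with h
  · exact ZMod.val_sub h
  · rw [← ZMod.val_cast_of_lt (show n + a.val - b.val < n by omega), Nat.cast_sub (by omega)]
    simp

theorem toSym2_injOn {n : ℕ} {e f : ℕ × ℕ} (he : e.1 < e.2 ∧ e.2 < n) (hf : f.1 < f.2 ∧ f.2 < n)
    (h : toSym2 n e = toSym2 n f) : e = f := by
  have key : ∀ x y : ℕ, x < n → y < n → (x : ZMod n) = y → x = y := by
    intro x y hx hy hxy
    simpa [ZMod.val_cast_of_lt hx, ZMod.val_cast_of_lt hy] using congrArg ZMod.val hxy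
  obtain ⟨a, b⟩ := e
  obtain ⟨c, d⟩ := f
  simp only [toSym2, Sym2.eq_iff] at *
  rcases h with ⟨h1, h2⟩ | ⟨h1, h2⟩
  · rw [key a c (by omega) (by omega) h1, key b d (by omega) (by omega) h2]
  · have := key a d (by omega) (by omega) h1
    have := key b c (by omega) (by omega) h2
    omega

theorem cyclicDist_cast {n a b : ℕ} (hab : a < b) (hb : b < n) :
    cyclicDist (a : ZMod n) (b : ZMod n) = min (b - a) (n + a - b) := by
  have : NeZero n := ⟨by omega⟩
  simp only [cyclicDist, val_sub_eq, ZMod.val_cast_of_lt hb,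
    ZMod.val_cast_of_lt (show a < n by omega)]
  rw [if_neg (by omega), if_pos (by omega), min_comm]

theorem cyclicDist_comm {n : ℕ} (i j : ZMod n) : cyclicDist i j = cyclicDist j i := min_comm _ _

theorem isDiagonal_toSym2 {n a b : ℕ} (hab : a < b) (hb : b < n) :
    IsDiagonal (toSym2 n (a, b)) ↔ a + 2 ≤ b ∧ b + 2 ≤ n + a := by
  have key : IsDiagonal (toSym2 n (a, b)) ↔ 2 ≤ cyclicDist (a : ZMod n) (b : ZMod n) := by
    constructor
    · rintro ⟨i, j, h, hd⟩
      rcases Sym2.eq_iff.mp h with ⟨rfl, rfl⟩ | ⟨rfl, rfl⟩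
      · exact hd
      · rwa [cyclicDist_comm]
    · exact fun h => ⟨_, _, rfl, h⟩
  rw [key, cyclicDist_cast hab hb]
  omega

theorem isEarCover_toSym2 {n a b : ℕ} (hab : a < b) (hb : b < n) :
    IsEarCover (toSym2 n (a, b)) ↔ min (b - a) (n + a - b) = 2 := by
  rw [← cyclicDist_cast hab hb]
  constructor
  · rintro ⟨i, j, h, hd⟩
    rcases Sym2.eq_iff.mp h with ⟨rfl, rfl⟩ | ⟨rfl, rfl⟩
    · exact hd
    · rwa [cyclicDist_comm]
  · exact fun h => ⟨_, _, rfl, h⟩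

theorem exists_toSym2_of_isDiagonal {n : ℕ} [NeZero n] {e : Sym2 (ZMod n)} (he : IsDiagonal e) :
    ∃ a b, a + 2 ≤ b ∧ b < n ∧ b + 2 ≤ n + a ∧ e = toSym2 n (a, b) := by
  obtain ⟨i, j, h, hd⟩ := id he
  have hi := i.val_lt
  have hj := j.val_lt
  rcases lt_trichotomy i.val j.val with hij | hij | hij
  · have heq : e = toSym2 n (i.val, j.val) := by simp [toSym2, h]
    rw [heq, isDiagonal_toSym2 hij hj] at he
    exact ⟨_, _, he.1, hj, he.2, heq⟩
  · rw [ZMod.val_injective n hij] at hd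
    simp [cyclicDist] at hd
  · have heq : e = toSym2 n (j.val, i.val) := by simp [toSym2, h, Sym2.eq_swap]
    rw [heq, isDiagonal_toSym2 hij hi] at he
    exact ⟨_, _, he.1, hi, he.2, heq⟩

theorem crosses_toSym2 {n : ℕ} {e f : ℕ × ℕ} (he : e.1 < e.2 ∧ e.2 < n)
    (hf : f.1 < f.2 ∧ f.2 < n) :
    Crosses (toSym2 n e) (toSym2 n f) ↔ Interleave e f := by
  have : NeZero n := ⟨by omega⟩
  obtain ⟨a, b⟩ := e
  obtain ⟨c, d⟩ := f
  simp only at he hf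
  have va := ZMod.val_cast_of_lt (show a < n by omega)
  have vb := ZMod.val_cast_of_lt (show b < n by omega)
  have vc := ZMod.val_cast_of_lt (show c < n by omega)
  have vd := ZMod.val_cast_of_lt (show d < n by omega)
  constructor
  · rintro ⟨x, y, z, w, h1, h2, h3, h4⟩
    simp only [toSym2, Sym2.eq_iff] at h1 h2
    simp only [Btw, val_sub_eq, Interleave] at *
    rcases h1 with ⟨rfl, rfl⟩ | ⟨rfl, rfl⟩ <;> rcases h2 with ⟨rfl, rfl⟩ | ⟨rfl, rfl⟩ <;>
      simp only [va, vb, vc, vd] at h3 h4 <;> split_ifs at h3 h4 <;> omega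
  · rintro (⟨h1, h2, h3⟩ | ⟨h1, h2, h3⟩)
    · refine ⟨a, b, c, d, rfl, rfl, ?_, ?_⟩ <;>
        simp only [Btw, val_sub_eq, va, vb, vc, vd] at * <;> split_ifs <;> omega
    · refine ⟨a, b, d, c, rfl, Sym2.eq_swap, ?_, ?_⟩ <;>
        simp only [Btw, val_sub_eq, va, vb, vc, vd] at * <;> split_ifs <;> omega

theorem exists_isTriangulation_superset {n : ℕ} [NeZero n] {T : Set (Sym2 (ZMod n))}
    (hd : ∀ e ∈ T, IsDiagonal e) (hc : ∀ e ∈ T, ∀ f ∈ T, ¬ Crosses e f) :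
    ∃ T', T ⊆ T' ∧ IsTriangulation T' := by
  obtain ⟨T', hTT', hT', hmax⟩ := Set.Finite.exists_le_maximal
    (s := {U : Set (Sym2 (ZMod n)) | (∀ e ∈ U, IsDiagonal e) ∧ ∀ e ∈ U, ∀ f ∈ U, ¬ Crosses e f})
    (Set.toFinite _) ⟨hd, hc⟩
  exact ⟨T', hTT', hT'.1, hT'.2, fun U h1 h2 h3 => (hmax ⟨h1, h2⟩ h3).antisymm h3⟩

theorem le_ncard_of_isBlockingSet {n : ℕ} (hn : 3 ≤ n) {B : Set (Sym2 (ZMod n))}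
    (hB : IsBlockingSet B) : n - 2 ≤ B.ncard := by
  classical
  have : NeZero n := ⟨by omega⟩
  by_contra! hlt
  let B' : Finset (ℕ × ℕ) := (Finset.range n ×ˢ Finset.range n).filter
    fun e => e.1 < e.2 ∧ toSym2 n e ∈ B
  have hmem : ∀ e, e ∈ B' ↔ e.1 < e.2 ∧ e.2 < n ∧ toSym2 n e ∈ B := by
    intro e
    simp only [B', Finset.mem_filter, Finset.mem_product, Finset.mem_range]
    constructor
    · rintro ⟨⟨h1, h2⟩, h3, h4⟩
      exact ⟨h3, h2, h4⟩
    · rintro ⟨h1, h2, h3⟩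
      exact ⟨⟨by omega, h2⟩, h1, h3⟩
  have hcard : B'.card ≤ B.ncard := by
    rw [← Set.ncard_coe_finset]
    refine Set.ncard_le_ncard_of_injOn (toSym2 n) (fun e he => ((hmem e).mp he).2.2) ?_
    intro e he f hf h
    have h1 := (hmem e).mp he
    have h2 := (hmem f).mp hf
    exact toSym2_injOn ⟨h1.1, h1.2.1⟩ ⟨h2.1, h2.2.1⟩ h
  obtain ⟨T, hT, hTT, hTB⟩ := exists_noncrossing_of_card (n - 3) (Finset.range n)
    (by rw [Finset.card_range]; omega) B' (by omega) (by
      rintro ⟨a, b⟩ he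
      obtain ⟨h1, h2, h3⟩ := (hmem _).mp he
      simp only at h1 h2
      obtain ⟨h4, h5⟩ := (isDiagonal_toSym2 h1 h2).mp (hB.1 _ h3)
      refine ⟨by simp; omega, by simp; omega, ⟨a + 1, by simp; omega, by simp, by simp; omega⟩, ?_⟩
      by_cases ha : a = 0
      · exact ⟨n - 1, by simp; omega, Or.inr (by simp; omega)⟩
      · exact ⟨0, by simp; omega, Or.inl (by simp; omega)⟩)
  have hlt' : ∀ e ∈ T, e.1 < e.2 ∧ e.2 < n := by
    intro e he
    obtain ⟨-, h2, ⟨x, -, h3, h4⟩, -⟩ := hT e he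
    exact ⟨h3.trans h4, Finset.mem_range.mp h2⟩
  obtain ⟨T', hTT', hT'⟩ := exists_isTriangulation_superset (T := toSym2 n '' T) (by
    rintro _ ⟨⟨a, b⟩, he, rfl⟩
    obtain ⟨h1, h2⟩ := hlt' _ he
    obtain ⟨-, -, ⟨x, hx, hx1, hx2⟩, y, hy, hy'⟩ := hT _ he
    rw [isDiagonal_toSym2 h1 h2]
    simp only [Finset.mem_range] at *
    omega) (by
    rintro _ ⟨e, he, rfl⟩ _ ⟨f, hf, rfl⟩
    rw [crosses_toSym2 (hlt' e he) (hlt' f hf)]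
    exact hTT e he f hf)
  obtain ⟨e, heB, heT⟩ := hB.2 T' hT'
  obtain ⟨a, b, h1, h2, -, rfl⟩ := exists_toSym2_of_isDiagonal (hB.1 e heB)
  obtain ⟨f, hf, hef⟩ := hTB (a, b) ((hmem _).mpr ⟨by simp; omega, h2, heB⟩)
  exact hT'.2.1 _ heT _ (hTT' ⟨f, hf, rfl⟩)
    ((crosses_toSym2 ⟨by simp; omega, h2⟩ (hlt' f hf)).mpr hef)

theorem exists_interleave_of_notMem {n : ℕ} {T : Set (Sym2 (ZMod n))} (hT : IsTriangulation T)
    {a b : ℕ} (hab : a + 2 ≤ b) (hb : b < n) (hba : b + 2 ≤ n + a) (h : toSym2 n (a, b) ∉ T) :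
    ∃ c d, c + 2 ≤ d ∧ d < n ∧ toSym2 n (c, d) ∈ T ∧ Interleave (a, b) (c, d) := by
  have : NeZero n := ⟨by omega⟩
  by_contra! hcon
  have hno : ∀ f ∈ T, ¬ Crosses (toSym2 n (a, b)) f ∧ ¬ Crosses f (toSym2 n (a, b)) := by
    intro f hf
    obtain ⟨c, d, h1, h2, -, rfl⟩ := exists_toSym2_of_isDiagonal (hT.1 f hf)
    have := hcon c d h1 h2 hf
    rw [crosses_toSym2 (by simp; omega) (by simp; omega),
      crosses_toSym2 (by simp; omega) (by simp; omega)]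
    simp only [Interleave] at *
    omega
  have heq := hT.2.2 (insert (toSym2 n (a, b)) T) (by
    rintro f (rfl | hf)
    · exact (isDiagonal_toSym2 (by omega) hb).mpr ⟨hab, hba⟩
    · exact hT.1 f hf) (by
    rintro f (rfl | hf) g (rfl | hg)
    · rw [crosses_toSym2 (by simp; omega) (by simp; omega)]
      simp [Interleave]
    · exact (hno g hg).1
    · exact (hno f hf).2
    · exact hT.2.1 f hf g hg) (Set.subset_insert _ _)
  exact h (heq ▸ Set.mem_insert _ _)

theorem not_interleave_of_mem {n : ℕ} {T : Set (Sym2 (ZMod n))} (hT : IsTriangulation T)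
    {a b c d : ℕ} (hab : a < b) (hb : b < n) (hcd : c < d) (hd : d < n)
    (h : toSym2 n (a, b) ∈ T) (h' : toSym2 n (c, d) ∈ T) : ¬ Interleave (a, b) (c, d) := by
  rw [← crosses_toSym2 (n := n) ⟨hab, hb⟩ ⟨hcd, hd⟩]
  exact hT.2.1 _ h _ h'

/-- A diagonal `{a, b}` of a triangulation has an ear-cover of the triangulation under it. -/
theorem exists_earCover_of_mem {n : ℕ} {T : Set (Sym2 (ZMod n))} (hT : IsTriangulation T)
    {a b : ℕ} (hab : a + 2 ≤ b) (hb : b + 1 < n) (h : toSym2 n (a, b) ∈ T) :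
    ∃ t, t + 2 ≤ b ∧ toSym2 n (t, t + 2) ∈ T := by
  induction hl : b - a using Nat.strong_induction_on generalizing a b with
  | _ l ih =>
    by_cases h2 : b = a + 2
    · exact ⟨a, by omega, h2 ▸ h⟩
    by_cases hm : toSym2 n (a, b - 1) ∈ T
    · obtain ⟨t, ht, htT⟩ := ih (b - 1 - a) (by omega) (by omega) (by omega) hm rfl
      exact ⟨t, by omega, htT⟩
    · obtain ⟨c, d, h3, h4, h5, h6⟩ :=
        exists_interleave_of_notMem hT (by omega) (by omega) (by omega) hm
      have h7 := not_interleave_of_mem hT (by omega) (by omega) (by omega) h4 h h5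
      simp only [Interleave] at h6 h7
      obtain rfl : d = b := by omega
      exact ih (d - c) (by omega) (by omega) hb h5 rfl

/-- The run of `j` consecutive ear-covers starting at vertex `0`. -/
def earRun (n j : ℕ) : Set (Sym2 (ZMod n)) := (fun t => toSym2 n (t, t + 2)) '' Set.Iio j

/-- The run of `n - 3` consecutive ear-covers, with one more diagonal from the vertex `n - 1`. -/
def runBlocker (n k : ℕ) : Set (Sym2 (ZMod n)) := insert (toSym2 n (k, n - 1)) (earRun n (n - 3))

theorem earRun_eq (n j : ℕ) : earRun n j =
    {e : Sym2 (ZMod n) | ∃ t : ℕ, t < j ∧ e = s((t : ZMod n), (t : ZMod n) + 2)} := by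
  ext e
  simp [earRun, toSym2, eq_comm]

theorem mem_earRun {n j a b : ℕ} (hj : j + 2 ≤ n) (hab : a < b) (hb : b < n) :
    toSym2 n (a, b) ∈ earRun n j ↔ a < j ∧ b = a + 2 := by
  constructor
  · rintro ⟨t, ht, h⟩
    have ht' : t < j := ht
    have := toSym2_injOn (by simp; omega) ⟨hab, hb⟩ h
    simp only [Prod.mk.injEq] at this
    omega
  · rintro ⟨h, rfl⟩
    exact ⟨a, h, rfl⟩

theorem ncard_earRun {n j : ℕ} (hj : j + 2 ≤ n) : (earRun n j).ncard = j := by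
  rw [earRun, Set.InjOn.ncard_image]
  · rw [← Finset.coe_Iio, Set.ncard_coe_finset, Nat.card_Iio]
  · intro s hs t ht h
    simp only [Set.mem_Iio] at hs ht
    exact (Prod.ext_iff.mp (toSym2_injOn (by simp; omega) (by simp; omega) h)).1

theorem ncard_runBlocker {n k : ℕ} (hn : 5 ≤ n) (hk : k + 3 ≤ n) :
    (runBlocker n k).ncard = n - 2 := by
  have : NeZero n := ⟨by omega⟩
  rw [runBlocker, Set.ncard_insert_of_notMem, ncard_earRun (by omega)]
  · omega
  · rw [mem_earRun (by omega) (by omega) (by omega)]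
    omega

theorem isBlocker_of_ncard_eq {n : ℕ} {B : Set (Sym2 (ZMod n))} (hn : 3 ≤ n)
    (hB : IsBlockingSet B) (hcard : B.ncard = n - 2) : IsBlocker B :=
  ⟨hB, fun _ hB' => hcard ▸ le_ncard_of_isBlockingSet hn hB'⟩

theorem isBlocker_runBlocker {n k : ℕ} (hn : 5 ≤ n) (hk2 : 2 ≤ k) (hk : k + 3 ≤ n) :
    IsBlocker (runBlocker n k) := by
  refine isBlocker_of_ncard_eq (by omega) ⟨?_, ?_⟩ (ncard_runBlocker hn hk)
  · rintro e (rfl | ⟨t, ht, rfl⟩)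
    · rw [isDiagonal_toSym2 (by omega) (by omega)]
      omega
    · simp only [Set.mem_Iio] at ht
      rw [isDiagonal_toSym2 (by omega) (by omega)]
      omega
  · intro T hT
    by_cases hm : toSym2 n (k, n - 1) ∈ T
    · exact ⟨_, Set.mem_insert _ _, hm⟩
    · obtain ⟨c, d, h1, h2, h3, h4⟩ :=
        exists_interleave_of_notMem hT (by omega) (by omega) (by omega) hm
      simp only [Interleave] at h4
      obtain ⟨t, ht, htT⟩ := exists_earCover_of_mem hT h1 (by omega) h3
      exact ⟨_, Set.mem_insert_of_mem _ ⟨t, by simp only [Set.mem_Iio]; omega, rfl⟩, htT⟩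

/-- The diagonals from the last vertex form a triangulation. -/
theorem isTriangulation_fan {n : ℕ} (hn : 3 ≤ n) :
    IsTriangulation ((fun k => toSym2 n (k, n - 1)) '' Set.Icc 1 (n - 3)) := by
  have : NeZero n := ⟨by omega⟩
  refine ⟨?_, ?_, fun T' hd hc hsub => Set.Subset.antisymm (fun e he => ?_) hsub⟩
  · rintro _ ⟨k, ⟨h1, h2⟩, rfl⟩
    rw [isDiagonal_toSym2 (by omega) (by omega)]
    omega
  · rintro _ ⟨k, ⟨h1, h2⟩, rfl⟩ _ ⟨l, ⟨h3, h4⟩, rfl⟩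
    rw [crosses_toSym2 (by simp; omega) (by simp; omega)]
    simp only [Interleave]
    omega
  · obtain ⟨a, b, h1, h2, h3, rfl⟩ := exists_toSym2_of_isDiagonal (hd e he)
    by_cases hb : b = n - 1
    · subst hb
      exact ⟨a, ⟨by omega, by omega⟩, rfl⟩
    · refine absurd ?_ (hc _ he _ (hsub ⟨a + 1, ⟨by omega, by omega⟩, rfl⟩))
      rw [crosses_toSym2 (by simp; omega) (by simp; omega)]
      simp only [Interleave]
      omega

theorem earCovers_runBlocker {n k : ℕ} (hk2 : 2 ≤ k) (hk : k + 3 ≤ n) :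
    {e ∈ runBlocker n k | IsEarCover e} = earRun n (if k = n - 3 then n - 2 else n - 3) := by
  have hrun : ∀ j, j + 2 ≤ n → ∀ e ∈ earRun n j, IsEarCover e := by
    rintro j hj _ ⟨t, ht, rfl⟩
    simp only [Set.mem_Iio] at ht
    rw [isEarCover_toSym2 (by omega) (by omega)]
    omega
  split_ifs with h
  · have hk' : toSym2 n (k, n - 1) = toSym2 n (n - 3, n - 3 + 2) := by
      congr 2
      omega
    have heq : runBlocker n k = earRun n (n - 2) := by
      have hins : Set.Iio (n - 2) = insert (n - 3) (Set.Iio (n - 3)) := by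
        ext t
        simp only [Set.mem_insert_iff, Set.mem_Iio]
        omega
      rw [runBlocker, hk', earRun, earRun, hins, Set.image_insert_eq]
    rw [heq]
    exact Set.sep_eq_self_iff_mem_true.mpr (hrun _ (by omega))
  · ext e
    constructor
    · rintro ⟨rfl | he, hear⟩
      · rw [isEarCover_toSym2 (by omega) (by omega)] at hear
        omega
      · exact he
    · exact fun he => ⟨Set.mem_insert_of_mem _ he, hrun _ (by omega) e he⟩

theorem eq_runBlocker_of_isBlocker {n j : ℕ} (hn : 5 ≤ n) (hj : j = n - 3 ∨ j = n - 2)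
    {B : Set (Sym2 (ZMod n))} (hB : IsBlocker B) (hear : {e ∈ B | IsEarCover e} = earRun n j) :
    ∃ k, 2 ≤ k ∧ k + 3 ≤ n ∧ runBlocker n k = B := by
  have : NeZero n := ⟨by omega⟩
  have hcard : B.ncard ≤ n - 2 := by
    rw [← ncard_runBlocker hn (k := 2) (by omega)]
    exact hB.2 _ (isBlocker_runBlocker hn le_rfl (by omega)).1
  obtain ⟨_, heB, k, ⟨hk1, hk⟩, rfl⟩ := hB.1.2 _ (isTriangulation_fan (n := n) (by omega))
  have hrun : earRun n (n - 3) ⊆ B := by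
    refine Set.Subset.trans (Set.image_mono fun t ht => ?_) (hear ▸ Set.sep_subset _ _)
    simp only [Set.mem_Iio] at *
    omega
  have hk2 : k ≠ 1 := by
    rintro rfl
    have : toSym2 n (1, n - 1) ∈ earRun n j := by
      rw [← hear]
      refine ⟨heB, ?_⟩
      rw [isEarCover_toSym2 (by omega) (by omega)]
      omega
    rw [mem_earRun (by omega) (by omega) (by omega)] at this
    omega
  refine ⟨k, by omega, by omega, Set.eq_of_subset_of_ncard_le (Set.insert_subset heB hrun) ?_⟩
  rwa [ncard_runBlocker hn (by omega)]

theorem runBlocker_injOn {n : ℕ} (hn : 5 ≤ n) : Set.InjOn (runBlocker n) (Set.Icc 2 (n - 3)) := by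
  rintro k ⟨hk2, hk⟩ l ⟨hl2, hl⟩ h
  have hmem : toSym2 n (k, n - 1) ∈ runBlocker n l := h ▸ Set.mem_insert _ _
  rcases hmem with hkl | hkl
  · exact (Prod.ext_iff.mp (toSym2_injOn (by simp; omega) (by simp; omega) hkl)).1
  · rw [mem_earRun (by omega) (by omega) (by omega)] at hkl
    omega

/-- f^{n-3}(n) + f^{n-2}(n) = n - 4. -/
theorem blockerCountRun_top_two {n : ℕ} (hn : 5 ≤ n) :
    blockerCountRun n (n - 3) + blockerCountRun n (n - 2) = n - 4 := by
  have : NeZero n := ⟨by omega⟩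
  simp only [blockerCountRun, ← earRun_eq]
  rw [← Set.ncard_union_eq]
  · have heq : {B | IsBlocker B ∧ {e ∈ B | IsEarCover e} = earRun n (n - 3)} ∪
        {B | IsBlocker B ∧ {e ∈ B | IsEarCover e} = earRun n (n - 2)} =
        runBlocker n '' Set.Icc 2 (n - 3) := by
      ext B
      constructor
      · rintro (⟨hB, hear⟩ | ⟨hB, hear⟩)
        · obtain ⟨k, h1, h2, h3⟩ := eq_runBlocker_of_isBlocker hn (Or.inl rfl) hB hear
          exact ⟨k, ⟨h1, by omega⟩, h3⟩
        · obtain ⟨k, h1, h2, h3⟩ := eq_runBlocker_of_isBlocker hn (Or.inr rfl) hB hear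
          exact ⟨k, ⟨h1, by omega⟩, h3⟩
      · rintro ⟨k, ⟨h1, h2⟩, rfl⟩
        have hB := isBlocker_runBlocker hn h1 (show k + 3 ≤ n by omega)
        have hear := earCovers_runBlocker h1 (show k + 3 ≤ n by omega)
        split_ifs at hear with h
        · exact Or.inr ⟨hB, hear⟩
        · exact Or.inl ⟨hB, hear⟩
    rw [heq, (runBlocker_injOn hn).ncard_image, ← Finset.coe_Icc,
      Set.ncard_coe_finset, Nat.card_Icc]
    omega
  · rw [Set.disjoint_left]
    rintro B ⟨-, h1⟩ ⟨-, h2⟩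
    have := congrArg Set.ncard (h1.symm.trans h2)
    rw [ncard_earRun (by omega), ncard_earRun (by omega)] at this
    omega

end ConvexBlockers
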